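/- Let d ≥ 1, T ≥ 1/2 and set t_0 := T − 1/2. Take G(m) := d_1(m, Leb|_{[0,1]^d}), where Leb|_{[0,1]^d} is the uniform probability measure on the unit cube [0,1]^d. Then there exist c_d > 0 and N_0 ∈ ℕ such that for every N ≥ N_0 there exists x^N ∈ ([0,1]^d)^N with V^N(t_0, x^N) − U(t_0, m^N_{x^N}) ≥ c_d N^{−1/d}. -/

import Mathlib

open MeasureTheory Filter
open scoped ENNReal NNReal BigOperators

noncomputable section

/-- `Ed d` is the Euclidean space `ℝ^d`. -/
abbrev Ed (d : ℕ) := EuclideanSpace ℝ (Fin d)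

/-- A Borel probability measure on `ℝ^d` with finite second moment,
i.e. an element of `P_2(ℝ^d)`. -/
def IsP2 {d : ℕ} (μ : Measure (Ed d)) : Prop :=
  IsProbabilityMeasure μ ∧ Integrable (fun x => ‖x‖ ^ 2) μ

/-- The empirical measure `m_x^N = (1/N) ∑ δ_{x^i}`. -/
def empMeas {d N : ℕ} (x : Fin N → Ed d) : Measure (Ed d) :=
  (N : ℝ≥0∞)⁻¹ • ∑ i, Measure.dirac (x i)

/-- `π` is a coupling of `μ` and `ν`. -/
def IsCoupling {d : ℕ} (π : Measure (Ed d × Ed d)) (μ ν : Measure (Ed d)) : Prop :=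
  IsProbabilityMeasure π ∧ π.map Prod.fst = μ ∧ π.map Prod.snd = ν

/-- The squared 2-Wasserstein distance `d_2(μ,ν)²`, as the infimum over couplings of
`∫ |x - y|² dπ(x,y)` (with value in `[0,∞]`). -/
def d2sq {d : ℕ} (μ ν : Measure (Ed d)) : ℝ≥0∞ :=
  ⨅ (π : Measure (Ed d × Ed d)) (_ : IsCoupling π μ ν),
    ∫⁻ p, (‖p.1 - p.2‖₊ : ℝ≥0∞) ^ 2 ∂π

/-- The 2-Wasserstein distance `d_2(μ,ν)`. -/
def d2 {d : ℕ} (μ ν : Measure (Ed d)) : ℝ := Real.sqrt (d2sq μ ν).toReal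

/-- The 1-Wasserstein distance, via Kantorovich duality:
`d_1(μ,ν) = sup { ∫ f dμ - ∫ f dν : f 1-Lipschitz }`. -/
def d1 {d : ℕ} (μ ν : Measure (Ed d)) : ℝ :=
  sSup { r | ∃ f : Ed d → ℝ, LipschitzWith 1 f ∧ r = (∫ x, f x ∂μ) - ∫ x, f x ∂ν }

/-- The Hopf–Lax mean-field value function
`U(t,m) = inf_{ν ∈ P_2} { G(ν) + d_2(m,ν)²/(2(T-t)) }`. -/
def MFval {d : ℕ} (T : ℝ) (G : Measure (Ed d) → ℝ) (t : ℝ) (m : Measure (Ed d)) : ℝ :=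
  sInf { r | ∃ ν : Measure (Ed d), IsP2 ν ∧
    r = G ν + (d2sq m ν).toReal / (2 * (T - t)) }

/-- The Hopf–Lax `N`-particle value function
`V^N(t,x) = inf_y { G(m_y^N) + (1/(2(T-t)N)) ∑ |x^i - y^i|² }`. -/
def NPval {d N : ℕ} (T : ℝ) (G : Measure (Ed d) → ℝ) (t : ℝ) (x : Fin N → Ed d) : ℝ :=
  sInf { r | ∃ y : Fin N → Ed d,
    r = G (empMeas y) + (1 / (2 * (T - t) * (N : ℝ))) * ∑ i, ‖x i - y i‖ ^ 2 }

/-- The unit cube `[0,1]^d ⊂ ℝ^d`. -/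
def unitCube (d : ℕ) : Set (Ed d) := {z | ∀ i, z i ∈ Set.Icc (0 : ℝ) 1}

/-- The uniform (Lebesgue) probability measure on the unit cube `[0,1]^d`. -/
def unifCube (d : ℕ) : Measure (Ed d) := volume.restrict (unitCube d)

/-- `HasQuantizer d n c`: some `n` points of the unit cube, each carrying unit mass, are
transported to `n` times the uniform measure at quadratic cost at most `c`. -/
def HasQuantizer (d n : ℕ) (c : ℝ) : Prop :=
  ∃ x : Fin n → Ed d, (∀ i, x i ∈ unitCube d) ∧ ∃ π : Measure (Ed d × Ed d),
    π.map Prod.fst = ∑ i, Measure.dirac (x i) ∧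
    π.map Prod.snd = (n : ℝ≥0∞) • unifCube d ∧
    ∫⁻ p, (‖p.1 - p.2‖₊ : ℝ≥0∞) ^ 2 ∂π ≤ ENNReal.ofReal c

lemma HasQuantizer.zero (d : ℕ) : HasQuantizer d 0 0 :=
  ⟨Fin.elim0, fun i => i.elim0, 0, by simp⟩

lemma HasQuantizer.add {d n m : ℕ} {a b : ℝ} (ha : 0 ≤ a) (hb : 0 ≤ b)
    (h₁ : HasQuantizer d n a) (h₂ : HasQuantizer d m b) : HasQuantizer d (n + m) (a + b) := by
  obtain ⟨x, hx, π, h1, h2, h3⟩ := h₁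
  obtain ⟨y, hy, ρ, k1, k2, k3⟩ := h₂
  refine ⟨Fin.append x y, fun i => ?_, π + ρ, ?_, ?_, ?_⟩
  · refine Fin.addCases (fun i => ?_) (fun i => ?_) i
    · simpa using hx i
    · simpa using hy i
  · rw [Measure.map_add _ _ measurable_fst, h1, k1, Fin.sum_univ_add]
    simp
  · rw [Measure.map_add _ _ measurable_snd, h2, k2, ← add_smul]
    simp
  · rw [lintegral_add_measure, ENNReal.ofReal_add ha hb]
    exact add_le_add h3 k3

lemma HasQuantizer.mul {d n : ℕ} {a : ℝ} (ha : 0 ≤ a) (h : HasQuantizer d n a) (q : ℕ) :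
    HasQuantizer d (q * n) (q * a) := by
  induction q with
  | zero => simpa using HasQuantizer.zero d
  | succ q ih =>
    have := ih.add (by positivity) ha h
    convert this using 1
    · ring
    · push_cast; ring

/-- The cell `∏ [aᵢ/k, (aᵢ+1)/k)` of the regular grid of mesh `1/k`. -/
def gridCell {d k : ℕ} (a : Fin d → Fin k) : Set (Ed d) :=
  {z | ∀ i, z i ∈ Set.Ico ((a i : ℝ) / k) (((a i : ℝ) + 1) / k)}

lemma measurableSet_gridCell {d k : ℕ} (a : Fin d → Fin k) : MeasurableSet (gridCell a) := by
  have : gridCell a = ⋂ i, (fun z : Ed d => z i) ⁻¹'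
      Set.Ico ((a i : ℝ) / k) (((a i : ℝ) + 1) / k) := by
    ext z; simp [gridCell]
  rw [this]
  exact MeasurableSet.iInter fun i =>
    (by fun_prop : Measurable fun z : Ed d => z i) measurableSet_Ico

lemma volume_gridCell {d k : ℕ} (a : Fin d → Fin k) :
    volume (gridCell a) = ENNReal.ofReal (1 / k) ^ d := by
  have : gridCell a = WithLp.ofLp ⁻¹'
      Set.univ.pi fun i => Set.Ico ((a i : ℝ) / k) (((a i : ℝ) + 1) / k) := by
    ext z; simp [gridCell]
  rw [this, (PiLp.volume_preserving_ofLp (Fin d)).measure_preimage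
    (MeasurableSet.univ_pi fun i => measurableSet_Ico).nullMeasurableSet, volume_pi,
    Measure.pi_pi]
  simp only [Real.volume_Ico]
  have h : ∀ i, ((a i : ℝ) + 1) / k - (a i : ℝ) / k = 1 / k := fun i => by ring
  simp [h]

lemma disjoint_gridCell {d k : ℕ} (hk : 0 < k) :
    Pairwise (Function.onFun Disjoint (gridCell (d := d) (k := k))) := by
  intro a b hab
  rw [Function.onFun, Set.disjoint_left]
  intro z ha hb
  apply hab
  ext i
  have hk' : (0 : ℝ) < k := by exact_mod_cast hk
  obtain ⟨h1, h2⟩ := ha i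
  obtain ⟨h3, h4⟩ := hb i
  rw [div_le_iff₀ hk'] at h1 h3
  rw [lt_div_iff₀ hk'] at h2 h4
  have e1 : (a i : ℝ) < b i + 1 := by linarith
  have e2 : (b i : ℝ) < a i + 1 := by linarith
  norm_cast at e1 e2
  omega

lemma gridCell_subset {d k : ℕ} (hk : 0 < k) (a : Fin d → Fin k) :
    gridCell a ⊆ unitCube d := by
  intro z hz i
  have hk' : (0 : ℝ) < k := by exact_mod_cast hk
  obtain ⟨h1, h2⟩ := hz i
  have : ((a i : ℕ) : ℝ) + 1 ≤ k := by exact_mod_cast (a i).2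
  exact ⟨le_trans (by positivity) h1, h2.le.trans ((div_le_one hk').2 this)⟩

lemma volume_unitCube (d : ℕ) : volume (unitCube d) = 1 := by
  have : unitCube d = WithLp.ofLp ⁻¹' Set.univ.pi fun _ => Set.Icc (0 : ℝ) 1 := by
    ext z; simp only [unitCube, Set.mem_preimage, Set.mem_univ_pi]; rfl
  rw [this, (PiLp.volume_preserving_ofLp (Fin d)).measure_preimage
    (MeasurableSet.univ_pi fun i => measurableSet_Icc).nullMeasurableSet, volume_pi,
    Measure.pi_pi]
  simp

instance isProbabilityMeasure_unifCube (d : ℕ) : IsProbabilityMeasure (unifCube d) :=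
  ⟨by simp [unifCube, volume_unitCube]⟩

lemma ofReal_one_div_pow_mul {k : ℕ} (hk : 0 < k) (d : ℕ) :
    ((k ^ d : ℕ) : ℝ≥0∞) * ENNReal.ofReal (1 / k) ^ d = 1 := by
  have hk' : (0 : ℝ) < k := by exact_mod_cast hk
  rw [Nat.cast_pow, ← mul_pow, ← ENNReal.ofReal_natCast k, ← ENNReal.ofReal_mul hk'.le,
    mul_one_div_cancel hk'.ne', ENNReal.ofReal_one, one_pow]

lemma sum_restrict_gridCell {d k : ℕ} (hk : 0 < k) :
    ∑ a : Fin d → Fin k, volume.restrict (gridCell a) = unifCube d := by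
  rw [← Measure.sum_fintype, ← Measure.restrict_iUnion (disjoint_gridCell hk)
    measurableSet_gridCell]
  refine Measure.restrict_congr_set (ae_eq_of_subset_of_measure_ge
    (Set.iUnion_subset fun a => gridCell_subset hk a) ?_
    (MeasurableSet.iUnion measurableSet_gridCell).nullMeasurableSet
    (by simp [volume_unitCube]))
  rw [measure_iUnion (disjoint_gridCell hk) measurableSet_gridCell, volume_unitCube]
  simp only [volume_gridCell, tsum_fintype, Finset.sum_const, Finset.card_univ,
    Fintype.card_fun, Fintype.card_fin, nsmul_eq_mul]
  exact (ofReal_one_div_pow_mul hk d).ge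

lemma norm_sub_sq_le_of_mem_gridCell {d k : ℕ} (hk : 0 < k) (a : Fin d → Fin k) {z : Ed d}
    (hz : z ∈ gridCell a) :
    ‖WithLp.toLp 2 (fun i => (a i : ℝ) / k) - z‖ ^ 2 ≤ d / (k : ℝ) ^ 2 := by
  have hk' : (0 : ℝ) < k := by exact_mod_cast hk
  rw [EuclideanSpace.norm_sq_eq]
  have h : ∀ i ∈ Finset.univ,
      ‖(WithLp.toLp 2 (fun i => (a i : ℝ) / k) - z) i‖ ^ 2 ≤ 1 / (k : ℝ) ^ 2 := by
    intro i _
    obtain ⟨h1, h2⟩ := hz i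
    rw [add_div] at h2
    rw [Real.norm_eq_abs, sq_abs, PiLp.sub_apply, ← one_div_pow]
    apply sq_le_sq'
    · simp only; linarith
    · have : (0 : ℝ) < 1 / k := by positivity
      simp only; linarith
  refine (Finset.sum_le_sum h).trans (le_of_eq ?_)
  simp [div_eq_mul_inv]

lemma hasQuantizer_grid (d : ℕ) {k : ℕ} (hk : 0 < k) :
    HasQuantizer d (k ^ d) ((k : ℝ) ^ d * (d / (k : ℝ) ^ 2)) := by
  have hk' : (0 : ℝ) < k := by exact_mod_cast hk
  let e := finFunctionFinEquiv (m := k) (n := d)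
  let p : (Fin d → Fin k) → Ed d := fun a => WithLp.toLp 2 (fun i => (a i : ℝ) / k)
  have hm : ∀ a, Measurable (Prod.mk (β := Ed d) (p a)) := fun a => by fun_prop
  refine ⟨fun j => p (e.symm j), fun j i => ?_,
    ((k ^ d : ℕ) : ℝ≥0∞) • ∑ a, (volume.restrict (gridCell a)).map (Prod.mk (p a)), ?_, ?_, ?_⟩
  · have : (((e.symm j) i : ℕ) : ℝ) ≤ k := by exact_mod_cast ((e.symm j) i).2.le
    exact ⟨by positivity, (div_le_one hk').2 this⟩
  · rw [Measure.map_smul, e.symm.sum_comp (fun a => Measure.dirac (p a)),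
      ← Measure.sum_fintype, Measure.map_sum measurable_fst.aemeasurable, Measure.sum_fintype,
      Finset.smul_sum]
    refine Finset.sum_congr rfl fun a _ => ?_
    rw [Measure.map_map measurable_fst (hm a)]
    have : Prod.fst ∘ Prod.mk (β := Ed d) (p a) = fun _ => p a := rfl
    rw [this, Measure.map_const, smul_smul, Measure.restrict_apply_univ, volume_gridCell,
      ofReal_one_div_pow_mul hk, one_smul]
  · rw [Measure.map_smul, ← sum_restrict_gridCell hk,
      ← Measure.sum_fintype, Measure.map_sum measurable_snd.aemeasurable, Measure.sum_fintype]
    congr 1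
    refine Finset.sum_congr rfl fun a _ => ?_
    rw [Measure.map_map measurable_snd (hm a)]
    exact Measure.map_id
  · rw [lintegral_smul_measure, lintegral_finsetSum_measure]
    have hc : ∀ a ∈ Finset.univ, ∫⁻ q, (‖q.1 - q.2‖₊ : ℝ≥0∞) ^ 2
        ∂((volume.restrict (gridCell a)).map (Prod.mk (p a))) ≤
        ENNReal.ofReal (d / (k : ℝ) ^ 2) * ENNReal.ofReal (1 / k) ^ d := by
      intro a _
      rw [lintegral_map (by fun_prop) (hm a), ← volume_gridCell a, ← setLIntegral_const]
      refine setLIntegral_mono measurable_const fun z hz => ?_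
      have := norm_sub_sq_le_of_mem_gridCell hk a hz
      rw [← enorm_eq_nnnorm, ← ofReal_norm, ← ENNReal.ofReal_pow (norm_nonneg _)]
      exact ENNReal.ofReal_le_ofReal this
    refine (mul_le_mul_right (Finset.sum_le_sum hc) _).trans (le_of_eq ?_)
    simp only [Finset.sum_const, Finset.card_univ, Fintype.card_fun, Fintype.card_fin,
      nsmul_eq_mul]
    rw [mul_comm (ENNReal.ofReal _) (_ ^ d), ← mul_assoc (Nat.cast _) (_ ^ d),
      ofReal_one_div_pow_mul hk, one_mul, ENNReal.ofReal_mul (by positivity),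
      ENNReal.ofReal_pow hk'.le, ENNReal.ofReal_natCast, Nat.cast_pow]

lemma HasQuantizer.exists_d2sq_le {d n : ℕ} {c : ℝ} (hn : 0 < n) (hc : 0 ≤ c)
    (h : HasQuantizer d n c) :
    ∃ x : Fin n → Ed d, (∀ i, x i ∈ unitCube d) ∧
      (d2sq (empMeas x) (unifCube d)).toReal ≤ c / n := by
  obtain ⟨x, hx, π, h1, h2, h3⟩ := h
  have hn0 : (n : ℝ≥0∞) ≠ 0 := by exact_mod_cast hn.ne'
  have hnt : (n : ℝ≥0∞) ≠ ∞ := ENNReal.natCast_ne_top n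
  have hn' : (0 : ℝ) < n := by exact_mod_cast hn
  refine ⟨x, hx, ?_⟩
  have hsnd : ((n : ℝ≥0∞)⁻¹ • π).map Prod.snd = unifCube d := by
    rw [Measure.map_smul, h2, smul_smul, ENNReal.inv_mul_cancel hn0 hnt, one_smul]
  have hcoup : IsCoupling ((n : ℝ≥0∞)⁻¹ • π) (empMeas x) (unifCube d) := by
    refine ⟨⟨?_⟩, ?_, hsnd⟩
    · have : ((n : ℝ≥0∞)⁻¹ • π).map Prod.snd Set.univ = 1 := by rw [hsnd]; simp
      rwa [Measure.map_apply measurable_snd MeasurableSet.univ, Set.preimage_univ] at this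
    · rw [Measure.map_smul, h1, empMeas]
  apply ENNReal.toReal_le_of_le_ofReal (by positivity)
  refine (iInf₂_le ((n : ℝ≥0∞)⁻¹ • π) hcoup).trans ?_
  rw [lintegral_smul_measure, div_eq_inv_mul, ENNReal.ofReal_mul (by positivity),
    ENNReal.ofReal_inv_of_pos hn', ENNReal.ofReal_natCast]
  exact mul_le_mul_right h3 _

lemma succ_pow_succ_le (k e : ℕ) (hk : 1 ≤ k) :
    (k + 1) ^ (e + 1) ≤ k ^ (e + 1) + 3 ^ (e + 1) * k ^ e := by
  induction e with
  | zero => simp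
  | succ e ih =>
    have h1 : k ^ e ≤ k ^ (e + 1) := Nat.pow_le_pow_right hk (by omega)
    have h2 : 1 ≤ 3 ^ (e + 1) := Nat.one_le_pow _ _ (by norm_num)
    calc (k + 1) ^ (e + 1 + 1) = (k + 1) ^ (e + 1) * (k + 1) := pow_succ _ _
      _ ≤ (k ^ (e + 1) + 3 ^ (e + 1) * k ^ e) * (k + 1) := Nat.mul_le_mul_right _ ih
      _ = k ^ (e + 1 + 1) + (k ^ (e + 1) + 3 ^ (e + 1) * k ^ (e + 1) + 3 ^ (e + 1) * k ^ e) := by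
        ring
      _ ≤ k ^ (e + 1 + 1) + (3 ^ (e + 1) * k ^ (e + 1) + 3 ^ (e + 1) * k ^ (e + 1)
          + 3 ^ (e + 1) * k ^ (e + 1)) := by
        gcongr
        exact Nat.le_mul_of_pos_left _ h2
      _ = k ^ (e + 1 + 1) + 3 ^ (e + 1 + 1) * k ^ (e + 1) := by ring

/-- A cube of side `k` plus a remainder of `r` points, the latter arranged in repeated grids of
mesh `1/j` and finitely many spare points. -/
lemma hasQuantizer_pow_add (d : ℕ) {k j : ℕ} (hk : 0 < k) (hj : 0 < j) (r : ℕ) :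
    ∃ c : ℝ, 0 ≤ c ∧ HasQuantizer d (k ^ d + r) c ∧
      c ≤ (k : ℝ) ^ d * (d / (k : ℝ) ^ 2) + (r * (d / (j : ℝ) ^ 2) + min (r : ℝ) ((j : ℝ) ^ d) * d) := by
  have h1 := hasQuantizer_grid d hk
  have h2 := (hasQuantizer_grid d hj).mul (by positivity) (r / j ^ d)
  have h3 := (hasQuantizer_grid d one_pos).mul (by positivity) (r % j ^ d)
  have h := h1.add (by positivity) (by positivity) (h2.add (by positivity) (by positivity) h3)
  rw [one_pow, mul_one, Nat.div_add_mod' r (j ^ d)] at h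
  refine ⟨_, ?_, h, ?_⟩
  · positivity
  · have e1 : ((r / j ^ d : ℕ) : ℝ) * (j : ℝ) ^ d ≤ r := by
      exact_mod_cast Nat.div_mul_le_self r (j ^ d)
    have e2 : ((r % j ^ d : ℕ) : ℝ) ≤ r := by exact_mod_cast Nat.mod_le _ _
    have e3 : ((r % j ^ d : ℕ) : ℝ) ≤ (j : ℝ) ^ d := by
      exact_mod_cast (Nat.mod_lt r (pow_pos hj d)).le
    rw [← mul_assoc]
    simp only [Nat.cast_one, one_pow, one_mul, div_one]
    gcongr
    exact le_min e2 e3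

lemma exists_hasQuantizer_le {d : ℕ} (hd : 1 ≤ d) {ε : ℝ} (hε : 0 < ε) :
    ∃ N0 : ℕ, 1 ≤ N0 ∧ ∀ N : ℕ, N0 ≤ N → ∃ c : ℝ, 0 ≤ c ∧ HasQuantizer d N c ∧
      c / N ≤ ε * (N : ℝ) ^ (-(1 / (d : ℝ))) := by
  obtain ⟨e, rfl⟩ : ∃ e, d = e + 1 := ⟨d - 1, by omega⟩
  set D : ℝ := ((e + 1 : ℕ) : ℝ) with hD
  have hDpos : 0 < D := by rw [hD]; positivity
  obtain ⟨j, hj⟩ := exists_nat_ge (max 1 (3 * D * 3 ^ (e + 1) / ε))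
  have hj1 : (1 : ℝ) ≤ j := (le_max_left _ _).trans hj
  have hj2 : 3 * D * 3 ^ (e + 1) ≤ ε * j := by
    have := (le_max_right _ _).trans hj
    rwa [div_le_iff₀ hε, mul_comm _ ε] at this
  have hj0 : 0 < j := by exact_mod_cast (lt_of_lt_of_le one_pos hj1)
  obtain ⟨M, hM⟩ := exists_nat_ge (max 1 (max (3 * D / ε) (3 * D * (j : ℝ) ^ (e + 1) / ε)))
  refine ⟨(M + 1) ^ (e + 1), Nat.one_le_pow _ _ (by omega), fun N hN => ?_⟩
  set R : ℝ := (N : ℝ) ^ (1 / D) with hR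
  have hN1 : 1 ≤ N := (Nat.one_le_pow _ _ (by omega)).trans hN
  have hNpos : (0 : ℝ) < N := by exact_mod_cast hN1
  have hRpos : 0 < R := Real.rpow_pos_of_pos hNpos _
  have hRN : R ^ (e + 1) = N := by
    rw [hR, hD, one_div, Real.rpow_inv_natCast_pow hNpos.le (by omega)]
  have hMR : (M : ℝ) + 1 ≤ R := by
    refine le_of_pow_le_pow_left₀ (n := e + 1) (by omega) hRpos.le ?_
    rw [hRN]; exact_mod_cast hN
  set k : ℕ := ⌊R⌋₊
  have hkR : (k : ℝ) ≤ R := Nat.floor_le hRpos.le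
  have hRk : R < k + 1 := Nat.lt_floor_add_one R
  have hMk : (M : ℝ) ≤ k := by linarith
  have hk1 : (1 : ℝ) ≤ k := (le_max_left _ _).trans (hM.trans hMk)
  have hk2 : 3 * D ≤ ε * k := by
    have := ((le_max_left _ _).trans (le_max_right _ _)).trans (hM.trans hMk)
    rwa [div_le_iff₀ hε, mul_comm _ ε] at this
  have hk3 : 3 * D * (j : ℝ) ^ (e + 1) ≤ ε * k := by
    have := ((le_max_right _ _).trans (le_max_right _ _)).trans (hM.trans hMk)
    rwa [div_le_iff₀ hε, mul_comm _ ε] at this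
  have hk0 : 0 < k := by exact_mod_cast (lt_of_lt_of_le one_pos hk1)
  have hkN : k ^ (e + 1) ≤ N := by
    have : (k : ℝ) ^ (e + 1) ≤ N := by rw [← hRN]; gcongr
    exact_mod_cast this
  have hNk : N < (k + 1) ^ (e + 1) := by
    have : (N : ℝ) < ((k : ℝ) + 1) ^ (e + 1) := by
      rw [← hRN]; exact pow_lt_pow_left₀ hRk hRpos.le (by omega)
    exact_mod_cast this
  obtain ⟨r, hrN⟩ := Nat.exists_eq_add_of_le hkN
  obtain ⟨c, hc0, hc, hcle⟩ := hasQuantizer_pow_add (e + 1) hk0 hj0 r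
  rw [← hrN] at hc
  refine ⟨c, hc0, hc, ?_⟩
  have hr : (r : ℝ) ≤ 3 ^ (e + 1) * (k : ℝ) ^ e := by
    have := succ_pow_succ_le k e hk0
    have : r ≤ 3 ^ (e + 1) * k ^ e := by omega
    exact_mod_cast this
  have hkpos : (0 : ℝ) < k := by linarith
  have hjpos : (0 : ℝ) < j := by linarith
  have b1 : (k : ℝ) ^ (e + 1) * (D / (k : ℝ) ^ 2) ≤ ε / 3 * (k : ℝ) ^ e := by
    have : (k : ℝ) ^ (e + 1) * (D / (k : ℝ) ^ 2) = D / k * (k : ℝ) ^ e := by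
      field_simp
      ring
    rw [this]
    gcongr ?_ * _
    rw [div_le_iff₀ hkpos]; linarith
  have b2 : (r : ℝ) * (D / (j : ℝ) ^ 2) ≤ ε / 3 * (k : ℝ) ^ e := by
    calc (r : ℝ) * (D / (j : ℝ) ^ 2) ≤ (3 ^ (e + 1) * (k : ℝ) ^ e) * (D / (j : ℝ) ^ 2) := by
          gcongr
      _ = (D * 3 ^ (e + 1) / (j : ℝ) ^ 2) * (k : ℝ) ^ e := by ring
      _ ≤ ε / 3 * (k : ℝ) ^ e := by
          gcongr ?_ * _
          rw [div_le_iff₀ (by positivity)]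
          nlinarith [mul_le_mul_of_nonneg_left hj1 (mul_pos hε hjpos).le]
  have b3 : min (r : ℝ) ((j : ℝ) ^ (e + 1)) * D ≤ ε / 3 * (k : ℝ) ^ e := by
    rcases Nat.eq_zero_or_pos e with rfl | he
    · have : r = 0 := by
        simp only [zero_add, pow_one] at hNk hrN
        omega
      subst this
      have : min ((0 : ℕ) : ℝ) ((j : ℝ) ^ (0 + 1)) = 0 := by simp
      rw [this, zero_mul]; positivity
    · have h1 : (k : ℝ) ≤ (k : ℝ) ^ e := le_self_pow₀ hk1 (by omega)
      calc min (r : ℝ) ((j : ℝ) ^ (e + 1)) * D ≤ (j : ℝ) ^ (e + 1) * D := by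
            gcongr; exact min_le_right _ _
        _ ≤ ε / 3 * k := by linarith
        _ ≤ _ := by gcongr
  have hce : c ≤ ε * (k : ℝ) ^ e := by linarith
  rw [Real.rpow_neg hNpos.le, ← hR, div_le_iff₀ hNpos, ← hRN]
  calc c ≤ ε * (k : ℝ) ^ e := hce
    _ ≤ ε * R ^ e := by gcongr
    _ = ε * R⁻¹ * R ^ (e + 1) := by field_simp; ring

lemma unitCube_subset_closedBall (d : ℕ) : unitCube d ⊆ Metric.closedBall 0 (d : ℝ) := by
  intro z hz
  rw [mem_closedBall_zero_iff]
  refine abs_le_of_sq_le_sq' ?_ (by positivity) |>.2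
  rw [EuclideanSpace.norm_sq_eq]
  have : ∀ i ∈ Finset.univ, ‖z i‖ ^ 2 ≤ 1 := fun i _ => by
    obtain ⟨h1, h2⟩ := hz i
    rw [Real.norm_eq_abs, sq_abs]; nlinarith
  refine (Finset.sum_le_sum this).trans ?_
  simp only [Finset.sum_const, Finset.card_univ, Fintype.card_fin, nsmul_eq_mul, mul_one]
  exact_mod_cast Nat.le_self_pow two_ne_zero d

lemma integrable_unifCube {d : ℕ} {f : Ed d → ℝ} (hf : Continuous f) :
    Integrable f (unifCube d) :=
  (hf.locallyIntegrable.integrableOn_isCompact (isCompact_closedBall (0 : Ed d) d)).mono_set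
    (unitCube_subset_closedBall d)

lemma isP2_unifCube (d : ℕ) : IsP2 (unifCube d) :=
  ⟨inferInstance, integrable_unifCube (by fun_prop)⟩

lemma isProbabilityMeasure_empMeas {d N : ℕ} (hN : 0 < N) (y : Fin N → Ed d) :
    IsProbabilityMeasure (empMeas y) := by
  refine ⟨?_⟩
  have hn0 : (N : ℝ≥0∞) ≠ 0 := by exact_mod_cast hN.ne'
  simp [empMeas, ENNReal.inv_mul_cancel hn0 (ENNReal.natCast_ne_top N)]

lemma integrable_empMeas {d N : ℕ} (hN : 0 < N) (y : Fin N → Ed d) (f : Ed d → ℝ) :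
    Integrable f (empMeas y) := by
  have hn0 : (N : ℝ≥0∞) ≠ 0 := by exact_mod_cast hN.ne'
  refine Integrable.smul_measure ?_ (ENNReal.inv_ne_top.2 hn0)
  exact integrable_finsetSum_measure.2 fun i _ => integrable_dirac (by simp)

lemma integral_empMeas {d N : ℕ} (y : Fin N → Ed d) (f : Ed d → ℝ) :
    ∫ x, f x ∂(empMeas y) = (N : ℝ)⁻¹ * ∑ i, f (y i) := by
  rw [empMeas, integral_smul_measure,
    integral_finsetSum_measure fun i _ => integrable_dirac (by simp)]
  simp

lemma d1_nonneg {d : ℕ} (μ ν : Measure (Ed d)) : 0 ≤ d1 μ ν := by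
  by_cases h : BddAbove
      { r | ∃ f : Ed d → ℝ, LipschitzWith 1 f ∧ r = (∫ x, f x ∂μ) - ∫ x, f x ∂ν }
  · exact le_csSup h ⟨fun _ => 0, LipschitzWith.const' 0, by simp⟩
  · rw [d1, Real.sSup_of_not_bddAbove h]

lemma d1_self {d : ℕ} (μ : Measure (Ed d)) : d1 μ μ = 0 := by
  have : { r | ∃ f : Ed d → ℝ, LipschitzWith 1 f ∧ r = (∫ x, f x ∂μ) - ∫ x, f x ∂μ } = {0} := by
    ext r
    simp only [sub_self, Set.mem_ofPred_eq, Set.mem_singleton_iff]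
    exact ⟨fun ⟨_, _, h⟩ => h, fun h => ⟨fun _ => 0, LipschitzWith.const' 0, h⟩⟩
  rw [d1, this, csSup_singleton]

lemma sub_integral_le_d1 {d : ℕ} {μ ν : Measure (Ed d)} [IsProbabilityMeasure μ]
    [IsProbabilityMeasure ν] (hμ : Integrable (fun x => ‖x‖) μ) (hν : Integrable (fun x => ‖x‖) ν)
    {f : Ed d → ℝ} (hf : LipschitzWith 1 f) :
    (∫ x, f x ∂μ) - ∫ x, f x ∂ν ≤ d1 μ ν := by
  refine le_csSup ⟨(∫ x, ‖x‖ ∂μ) + ∫ x, ‖x‖ ∂ν, ?_⟩ ⟨f, hf, rfl⟩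
  rintro _ ⟨g, hg, rfl⟩
  have hb : ∀ x, |g x - g 0| ≤ ‖x‖ := fun x => by
    have := hg.dist_le_mul x 0
    rwa [Real.dist_eq, NNReal.coe_one, one_mul, dist_zero_right] at this
  have hdev : ∀ (ρ : Measure (Ed d)) [IsProbabilityMeasure ρ], Integrable (fun x => ‖x‖) ρ →
      |(∫ x, g x ∂ρ) - g 0| ≤ ∫ x, ‖x‖ ∂ρ := by
    intro ρ _ hρ
    have hi : Integrable (fun x => g x - g 0) ρ :=
      hρ.mono' (hg.continuous.sub continuous_const).aestronglyMeasurable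
        (Eventually.of_forall fun x => by simpa using hb x)
    have hg' : Integrable g ρ := by
      exact (hi.add (integrable_const (g 0))).congr (Eventually.of_forall fun x => by simp)
    have : (∫ x, g x ∂ρ) - g 0 = ∫ x, (g x - g 0) ∂ρ := by
      rw [integral_sub hg' (integrable_const _)]; simp
    rw [this]
    exact (abs_integral_le_integral_abs).trans
      (integral_mono hi.abs hρ hb)
  have h1 := abs_le.1 (hdev μ hμ)
  have h2 := abs_le.1 (hdev ν hν)
  linarith [h1.2, h2.1]

/-- Points at distance at least `r` from `N` given points fill at least half of the unit cube
as soon as the `N` balls of radius `r` have total volume at most `1/2`. -/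
lemma half_mul_le_d1_empMeas {d N : ℕ} (hN : 0 < N) {r : ℝ} (hr : 0 < r)
    (hvol : N * (r ^ d * (volume (Metric.ball (0 : Ed d) 1)).toReal) ≤ 1 / 2)
    (y : Fin N → Ed d) :
    r / 2 ≤ d1 (empMeas y) (unifCube d) := by
  have := isProbabilityMeasure_empMeas hN y
  set S : Set (Ed d) := Set.range y
  have hSne : S.Nonempty := ⟨y ⟨0, hN⟩, ⟨_, rfl⟩⟩
  have hlip : LipschitzWith 1 (fun z : Ed d => -Metric.infDist z S) :=
    (Metric.lipschitz_infDist_pt S).neg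
  have hcont : Continuous fun z : Ed d => Metric.infDist z S := Metric.continuous_infDist_pt S
  refine le_trans ?_ (sub_integral_le_d1 (integrable_empMeas hN y _)
    (integrable_unifCube (by fun_prop)) hlip)
  have h0 : ∑ i, -Metric.infDist (y i) S = 0 :=
    Finset.sum_eq_zero fun i _ => by
      rw [Metric.infDist_zero_of_mem (Set.mem_range_self i), neg_zero]
  rw [integral_empMeas, h0, mul_zero, zero_sub, integral_neg, neg_neg]
  refine le_trans ?_ (mul_meas_ge_le_integral_of_nonneg
    (Eventually.of_forall fun z => Metric.infDist_nonneg) (integrable_unifCube hcont) r)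
  have hsub : {z : Ed d | r ≤ Metric.infDist z S}ᶜ ⊆ ⋃ i, Metric.ball (y i) r := by
    intro z hz
    simp only [Set.mem_compl_iff, Set.mem_ofPred_eq, not_le] at hz
    obtain ⟨_, ⟨i, rfl⟩, hi⟩ := (Metric.infDist_lt_iff hSne).1 hz
    exact Set.mem_iUnion.2 ⟨i, hi⟩
  have hball : ∀ i, (unifCube d).real (Metric.ball (y i) r) ≤
      r ^ d * (volume (Metric.ball (0 : Ed d) 1)).toReal := by
    intro i
    have h1 : unifCube d (Metric.ball (y i) r) ≤ volume (Metric.ball (y i) r) :=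
      Measure.restrict_apply_le _ _
    have h2 := ENNReal.toReal_mono measure_ball_lt_top.ne h1
    rw [Measure.addHaar_ball_of_pos volume _ hr, ENNReal.toReal_mul,
      ENNReal.toReal_ofReal (by positivity)] at h2
    simpa [Measure.real] using h2
  have hcompl : (unifCube d).real {z : Ed d | r ≤ Metric.infDist z S}ᶜ ≤ 1 / 2 := by
    refine (measureReal_mono hsub).trans ((measureReal_iUnion_fintype_le _).trans ?_)
    refine (Finset.sum_le_sum fun i _ => hball i).trans ?_
    simpa using hvol
  have hms : MeasurableSet {z : Ed d | r ≤ Metric.infDist z S} :=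
    measurableSet_le measurable_const hcont.measurable
  rw [probReal_compl_eq_one_sub hms] at hcompl
  nlinarith

lemma MFval_le_d2sq {d : ℕ} {T t : ℝ} (ht : t < T) (m : Measure (Ed d)) :
    MFval T (fun m => d1 m (unifCube d)) t m ≤ (d2sq m (unifCube d)).toReal / (2 * (T - t)) := by
  have ht' : 0 < T - t := sub_pos.2 ht
  refine csInf_le ⟨0, ?_⟩ ⟨unifCube d, isP2_unifCube d, by simp [d1_self]⟩
  rintro _ ⟨ν, -, rfl⟩
  exact add_nonneg (d1_nonneg _ _) (by positivity)

lemma le_NPval {d N : ℕ} {T t : ℝ} (ht : t < T) {G : Measure (Ed d) → ℝ} {b : ℝ}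
    (hb : ∀ y : Fin N → Ed d, b ≤ G (empMeas y)) (x : Fin N → Ed d) :
    b ≤ NPval T G t x := by
  have ht' : 0 < T - t := sub_pos.2 ht
  refine le_csInf ⟨_, x, rfl⟩ ?_
  rintro _ ⟨y, rfl⟩
  have : 0 ≤ (1 / (2 * (T - t) * (N : ℝ))) * ∑ i, ‖x i - y i‖ ^ 2 := by positivity
  linarith [hb y]

/-- optimality of the `N^{-1/d}` bound: with terminal cost
`G(m) = d_1(m, Leb|_{[0,1]^d})` and `t_0 = T - 1/2`, there are `c_d > 0` and `N_0` such that
for every `N ≥ N_0` there is `x^N ∈ ([0,1]^d)^N` with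
`V^N(t_0, x^N) - U(t_0, m^N_{x^N}) ≥ c_d N^{-1/d}`. -/
theorem optimality_lower_bound {d : ℕ} (hd : 1 ≤ d) (T : ℝ) (hT : 1 / 2 ≤ T) :
    ∃ c : ℝ, 0 < c ∧ ∃ N0 : ℕ, ∀ N : ℕ, N0 ≤ N → ∃ x : Fin N → Ed d,
      (∀ i, x i ∈ unitCube d) ∧
      c * (N : ℝ) ^ (-(1 / (d : ℝ))) ≤
        NPval T (fun m => d1 m (unifCube d)) (T - 1 / 2) x
          - MFval T (fun m => d1 m (unifCube d)) (T - 1 / 2) (empMeas x) := by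
  set ω : ℝ := (volume (Metric.ball (0 : Ed d) 1)).toReal
  have hωpos : 0 < ω := ENNReal.toReal_pos
    (Metric.measure_ball_pos volume _ one_pos).ne' measure_ball_lt_top.ne
  set a : ℝ := min 1 (1 / (2 * ω))
  have hapos : 0 < a := lt_min one_pos (by positivity)
  have haω : a ^ d * ω ≤ 1 / 2 := by
    have h1 : a ^ d ≤ a := pow_le_of_le_one hapos.le (min_le_left _ _) (by omega)
    have h2 : a * ω ≤ 1 / (2 * ω) * ω := by gcongr; exact min_le_right _ _
    have h3 : 1 / (2 * ω) * ω = 1 / 2 := by field_simp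
    nlinarith
  obtain ⟨N0, hN0, hq⟩ := exists_hasQuantizer_le hd (ε := a / 4) (by positivity)
  refine ⟨a / 4, by positivity, N0, fun N hN => ?_⟩
  have hNpos : 0 < N := hN0.trans hN
  have hNpos' : (0 : ℝ) < N := by exact_mod_cast hNpos
  obtain ⟨c, hc0, hc, hcle⟩ := hq N hN
  obtain ⟨x, hx, hxle⟩ := hc.exists_d2sq_le hNpos hc0
  refine ⟨x, hx, ?_⟩
  set ρ : ℝ := (N : ℝ) ^ (-(1 / (d : ℝ))) with hρ
  have hρpos : 0 < ρ := Real.rpow_pos_of_pos hNpos' _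
  have hρd : N * ρ ^ d = 1 := by
    rw [hρ, Real.rpow_neg hNpos'.le, inv_pow, one_div,
      Real.rpow_inv_natCast_pow hNpos'.le (by omega), mul_inv_cancel₀ hNpos'.ne']
  have ht : T - 1 / 2 < T := by linarith
  have hV : a * ρ / 2 ≤ NPval T (fun m => d1 m (unifCube d)) (T - 1 / 2) x :=
    le_NPval ht (half_mul_le_d1_empMeas hNpos (by positivity) (by
      calc N * ((a * ρ) ^ d * ω) = (N * ρ ^ d) * (a ^ d * ω) := by rw [mul_pow]; ring
        _ ≤ 1 / 2 := by rw [hρd, one_mul]; exact haω)) x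
  have hU := MFval_le_d2sq ht (empMeas x)
  have h2 : 2 * (T - (T - 1 / 2)) = 1 := by ring
  rw [h2, div_one] at hU
  linarith

end
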